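/- Let d, N ≥ 1, λ > 0, Q > 0, L ≥ 0, β ≥ 1, and let φ_1, …, φ_N ∈ ℝ^d satisfy ‖φ_n‖₂ ≤ Q for every n. Define V_0 = λ I_d and V_n = V_{n−1} + φ_n φ_nᵀ for n ≥ 1. Suppose ρ_1, …, ρ_N are real numbers satisfying ρ_n ≤ min( 2L, 2Lβ‖φ_n‖_{V_{n−1}⁻¹} ) for every n, where ‖x‖_A := √(xᵀ A x). Then ∑_{n=1}^N ρ_n ≤ 2 L β √( 2 N d log(1 + N Q² / (λ d)) ). -/

import Mathlib

open scoped Matrix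

/-- The weighted norm `‖x‖_A := √(xᵀ A x)` associated to a (positive definite) matrix `A`. -/
noncomputable def wnorm {d : ℕ} (A : Matrix (Fin d) (Fin d) ℝ) (x : Fin d → ℝ) : ℝ :=
  Real.sqrt (x ⬝ᵥ A.mulVec x)

lemma aux_min {w : ℝ} (hw : 0 ≤ w) :
    (min 1 w) ^ 2 ≤ 2 * Real.log (1 + w ^ 2) := by
  set m := min 1 w with hm
  have hm0 : 0 ≤ m := le_min zero_le_one hw
  have hm1 : m ≤ 1 := min_le_left _ _
  have hmw : m ≤ w := min_le_right _ _
  have h1 : Real.log (1 + m ^ 2) ≤ Real.log (1 + w ^ 2) := by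
    apply Real.log_le_log (by positivity)
    gcongr
  have h2 := Real.one_sub_inv_le_log_of_pos (show 0 < 1 + m ^ 2 by positivity)
  have h3 : m ^ 2 / 2 ≤ 1 - (1 + m ^ 2)⁻¹ := by
    have hp : 0 < 1 + m ^ 2 := by positivity
    have : 1 - (1 + m ^ 2)⁻¹ = m ^ 2 / (1 + m ^ 2) := by field_simp; ring
    rw [this]
    apply div_le_div_of_nonneg_left (by positivity) hp
    nlinarith
  linarith

lemma aux_det {d : ℕ} (A : Matrix (Fin d) (Fin d) ℝ) (hA : IsUnit A.det) (x : Fin d → ℝ) :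
    (A + Matrix.vecMulVec x x).det = A.det * (1 + x ⬝ᵥ A⁻¹.mulVec x) := by
  have h := Matrix.det_add_replicateCol_mul_replicateRow (ι := Unit) hA x x
  rw [Matrix.vecMulVec_eq Unit, h]
  congr 1
  rw [Matrix.det_unique, Matrix.add_apply, Matrix.one_apply_eq, Matrix.mul_assoc,
    ← Matrix.replicateCol_mulVec]
  simp [Matrix.mul_apply, dotProduct]

lemma aux_logdet {d : ℕ} (A : Matrix (Fin d) (Fin d) ℝ) (hA : A.PosDef) (a : ℝ) (ha : 0 < a)
    (htr : A.trace ≤ d * a) : Real.log A.det ≤ d * Real.log a := by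
  have hd := hA.1.det_eq_prod_eigenvalues
  have ht := hA.1.trace_eq_sum_eigenvalues
  simp only [RCLike.ofReal_real_eq_id, id] at hd ht
  rw [hd, Real.log_prod (fun i _ => (hA.eigenvalues_pos i).ne')]
  have : ∀ i ∈ Finset.univ, Real.log (hA.1.eigenvalues i) ≤
      Real.log a + (hA.1.eigenvalues i / a - 1) := by
    intro i _
    have hp := hA.eigenvalues_pos i
    have := Real.log_le_sub_one_of_pos (div_pos hp ha)
    rw [Real.log_div hp.ne' ha.ne'] at this
    linarith
  refine (Finset.sum_le_sum this).trans ?_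
  rw [Finset.sum_add_distrib, Finset.sum_sub_distrib, ← Finset.sum_div, ← ht]
  have : A.trace / a ≤ d := by rwa [div_le_iff₀ ha]
  simp
  linarith

/-- Let `d, N ≥ 1`, `λ > 0`, `Q > 0`, `L ≥ 0`, `β ≥ 1`, and let
`φ_1, …, φ_N ∈ ℝ^d` satisfy `‖φ_n‖₂ ≤ Q`. With `V_0 = λ I_d`, `V_n = V_{n−1} + φ_n φ_nᵀ`,
if `ρ_n ≤ min(2L, 2Lβ‖φ_n‖_{V_{n−1}⁻¹})` for every `n`, then
`∑_{n=1}^N ρ_n ≤ 2 L β √(2 N d log(1 + N Q² / (λ d)))`.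
(Here `φ (n : Fin N)` is the `(n+1)`-th feature vector, so it is paired with `V n`.) -/
theorem cumulative_regret_sum_bound
    (d N : ℕ) (hd : 1 ≤ d) (hN : 1 ≤ N) (lam Q L β : ℝ)
    (hlam : 0 < lam) (hQ : 0 < Q) (hL : 0 ≤ L) (hβ : 1 ≤ β)
    (φ : Fin N → Fin d → ℝ) (hφ : ∀ n, Real.sqrt (φ n ⬝ᵥ φ n) ≤ Q)
    (V : ℕ → Matrix (Fin d) (Fin d) ℝ)
    (hV0 : V 0 = lam • (1 : Matrix (Fin d) (Fin d) ℝ))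
    (hVs : ∀ n : Fin N, V (n + 1) = V n + Matrix.vecMulVec (φ n) (φ n))
    (ρ : Fin N → ℝ)
    (hρ : ∀ n, ρ n ≤ min (2 * L) (2 * L * β * wnorm (V n)⁻¹ (φ n))) :
    ∑ n : Fin N, ρ n ≤
      2 * L * β * Real.sqrt (2 * N * d * Real.log (1 + N * Q ^ 2 / (lam * d))) := by
  have hφ2 : ∀ n, φ n ⬝ᵥ φ n ≤ Q ^ 2 := fun n => (Real.sqrt_le_left hQ.le).1 (hφ n)
  have hd0 : (0 : ℝ) < d := by exact_mod_cast hd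
  have key : ∀ k : ℕ, ∀ hk : k ≤ N, (V k).PosDef ∧ (V k).trace ≤ d * lam + k * Q ^ 2 ∧
      Real.log (V k).det = d * Real.log lam +
        ∑ n : Fin k, Real.log (1 + wnorm (V n)⁻¹ (φ (Fin.castLE hk n)) ^ 2) := by
    intro k
    induction k with
    | zero =>
      intro _
      rw [hV0]
      refine ⟨Matrix.PosDef.one.smul hlam, ?_, ?_⟩
      · simp [mul_comm]
      · simp
    | succ k ih =>
      intro hk
      obtain ⟨h1, h2, h3⟩ := ih (by omega)
      have hs := hVs ⟨k, hk⟩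
      simp only at hs
      set x := φ ⟨k, hk⟩ with hx
      have hw : wnorm (V k)⁻¹ x ^ 2 = x ⬝ᵥ (V k)⁻¹.mulVec x := by
        apply Real.sq_sqrt
        have := h1.inv.posSemidef.dotProduct_mulVec_nonneg x
        simpa using this
      have hdet := aux_det (V k) h1.det_pos.ne'.isUnit x
      refine ⟨?_, ?_, ?_⟩
      · rw [hs]
        apply h1.add_posSemidef
        have := Matrix.posSemidef_vecMulVec_self_star x
        simpa using this
      · rw [hs, Matrix.trace_add, Matrix.trace_vecMulVec]
        have := hφ2 ⟨k, hk⟩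
        push_cast
        linarith
      · rw [hs, hdet, ← hw, Real.log_mul h1.det_pos.ne' (by positivity), h3,
          Fin.sum_univ_castSucc, add_assoc]
        rfl
  obtain ⟨h1, h2, h3⟩ := key N le_rfl
  have hN0 : (0 : ℝ) < N := by exact_mod_cast hN
  set B := Real.log (1 + N * Q ^ 2 / (lam * d)) with hB
  have ha : 0 < 1 + N * Q ^ 2 / (lam * d) := by positivity
  have h4 := aux_logdet (V N) h1 (lam * (1 + N * Q ^ 2 / (lam * d))) (by positivity)
    (h2.trans_eq (by field_simp))
  rw [Real.log_mul hlam.ne' ha.ne', h3, ← hB] at h4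
  have hsum : ∑ n : Fin N, Real.log (1 + wnorm (V n)⁻¹ (φ n) ^ 2) ≤ d * B := by
    have : ∑ n : Fin N, Real.log (1 + wnorm (V n)⁻¹ (φ (Fin.castLE le_rfl n)) ^ 2) ≤ d * B := by
      linarith
    exact this
  have hw0 : ∀ n : Fin N, 0 ≤ wnorm (V n)⁻¹ (φ n) := fun n => Real.sqrt_nonneg _
  have hms : ∑ n : Fin N, min 1 (wnorm (V n)⁻¹ (φ n)) ≤ Real.sqrt (2 * N * d * B) := by
    apply Real.le_sqrt_of_sq_le
    refine sq_sum_le_card_mul_sum_sq.trans ?_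
    have : ∑ n : Fin N, (min 1 (wnorm (V n)⁻¹ (φ n))) ^ 2 ≤ 2 * (d * B) := by
      refine (Finset.sum_le_sum fun n _ => aux_min (hw0 n)).trans ?_
      rw [← Finset.mul_sum]
      linarith
    rw [Finset.card_univ, Fintype.card_fin]
    calc _ ≤ (N : ℝ) * (2 * (d * B)) := by gcongr
      _ = _ := by ring
  calc ∑ n : Fin N, ρ n ≤ ∑ n : Fin N, 2 * L * β * min 1 (wnorm (V n)⁻¹ (φ n)) := by
        apply Finset.sum_le_sum
        intro n _
        have hc : 0 ≤ 2 * L * β := by positivity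
        rw [mul_min_of_nonneg _ _ hc]
        refine (hρ n).trans (min_le_min ?_ le_rfl)
        nlinarith
    _ = 2 * L * β * ∑ n : Fin N, min 1 (wnorm (V n)⁻¹ (φ n)) := by rw [Finset.mul_sum]
    _ ≤ _ := by gcongr
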